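/- arXiv:math/0410303 — 2 statements merged into one kernel-verified Lean document; each statement's English description precedes it below -/
import Mathlib

section
/- Let R be a commutative Noetherian ring, I an ideal, T an R-module, and U, V, W, Z finitely generated submodules of T with Z ⊆ U and W ⊆ V. Set L_n := (U + I^n V)/(Z + I^n W), and assume L_n has finite length for all sufficiently large n. Then there exists a polynomial p with rational coefficients such that λ(L_n) = p(n) for all sufficiently large n. -/
/-- The length `λ(M)` of a module `M`, i.e. the supremum of lengths of chains of submodules,
realized as the Krull dimension of the lattice of submodules of `M`. -/
noncomputable def moduleLength (R M : Type*) [Ring R] [AddCommGroup M] [Module R M] :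
    WithBot ℕ∞ :=
  Order.krullDim (Submodule R M)

open Filter

/-- An extended-natural-valued sequence that is finite and given by a rational polynomial for all
sufficiently large arguments. -/
def IsEventuallyPolynomial (f : ℕ → ℕ∞) : Prop :=
  ∃ p : Polynomial ℚ, ∀ᶠ n in atTop, ∃ l : ℕ, f n = l ∧ (l : ℚ) = p.eval (n : ℚ)

theorem Polynomial.exists_eval_add_one_sub_eval (q : Polynomial ℚ) :
    ∃ p : Polynomial ℚ, ∀ x : ℚ, p.eval (x + 1) - p.eval x = q.eval x := by
  induction q using Polynomial.induction_on' with
  | add q₁ q₂ h₁ h₂ =>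
    obtain ⟨p₁, h₁⟩ := h₁
    obtain ⟨p₂, h₂⟩ := h₂
    refine ⟨p₁ + p₂, fun x => ?_⟩
    rw [Polynomial.eval_add, Polynomial.eval_add, Polynomial.eval_add, ← h₁, ← h₂]
    ring
  | monomial k a =>
    refine ⟨Polynomial.C (a / (k + 1)) * Polynomial.bernoulli (k + 1), fun x => ?_⟩
    have hk : (k : ℚ) + 1 ≠ 0 := by positivity
    rw [Polynomial.eval_mul, Polynomial.eval_mul, add_comm x, Polynomial.bernoulli_eval_one_add]
    simp
    field_simp
    ring

namespace IsEventuallyPolynomial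

theorem zero : IsEventuallyPolynomial 0 :=
  ⟨0, Eventually.of_forall fun _ => ⟨0, by simp⟩⟩

theorem congr {f g : ℕ → ℕ∞} (hf : IsEventuallyPolynomial f) (h : f =ᶠ[atTop] g) :
    IsEventuallyPolynomial g := by
  obtain ⟨p, hp⟩ := hf
  refine ⟨p, ?_⟩
  filter_upwards [hp, h] with n hn hfg
  rwa [← hfg]

theorem add {f g : ℕ → ℕ∞} (hf : IsEventuallyPolynomial f) (hg : IsEventuallyPolynomial g) :
    IsEventuallyPolynomial (f + g) := by
  obtain ⟨p, hp⟩ := hf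
  obtain ⟨q, hq⟩ := hg
  refine ⟨p + q, ?_⟩
  filter_upwards [hp, hq] with n ⟨k, hk, hkp⟩ ⟨l, hl, hlq⟩
  exact ⟨k + l, by simp [hk, hl], by simp [hkp, hlq]⟩

theorem comp_add_one {f : ℕ → ℕ∞} (hf : IsEventuallyPolynomial f) :
    IsEventuallyPolynomial fun n => f (n + 1) := by
  obtain ⟨p, hp⟩ := hf
  refine ⟨p.comp (Polynomial.X + 1), ?_⟩
  filter_upwards [(tendsto_add_atTop_nat 1).eventually hp] with n ⟨l, hl, hlp⟩
  exact ⟨l, hl, by simpa using hlp⟩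

theorem of_add_eq_add {f a b : ℕ → ℕ∞} (hf : ∀ᶠ n in atTop, f n ≠ ⊤)
    (ha : IsEventuallyPolynomial a) (hb : IsEventuallyPolynomial b)
    (h : ∀ n, f (n + 1) + b n = f n + a n) : IsEventuallyPolynomial f := by
  obtain ⟨p, hp⟩ := ha
  obtain ⟨q, hq⟩ := hb
  obtain ⟨r, hr⟩ := Polynomial.exists_eval_add_one_sub_eval (p - q)
  obtain ⟨N, hN⟩ := eventually_atTop.mp ((hf.and hp).and hq)
  have hnat : ∀ n ≥ N, f n = ((f n).toNat : ℕ∞) := fun n hn =>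
    (ENat.natCast_toNat (hN n hn).1.1).symm
  have hstep : ∀ n ≥ N, ((f (n + 1)).toNat : ℚ) - r.eval ((n : ℚ) + 1) =
      ((f n).toNat : ℚ) - r.eval (n : ℚ) := by
    intro n hn
    obtain ⟨⟨-, k, hk, hkp⟩, l, hl, hlq⟩ := hN n hn
    have e := h n
    rw [hnat n hn, hnat (n + 1) (by lia), hk, hl] at e
    have e' : ((f (n + 1)).toNat : ℚ) + l = (f n).toNat + k := by exact_mod_cast e
    have := hr n
    rw [Polynomial.eval_sub] at this
    linarith
  refine ⟨r + Polynomial.C ((f N).toNat - r.eval (N : ℚ)), eventually_atTop.mpr ⟨N, fun n hn => ?_⟩⟩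
  refine ⟨(f n).toNat, hnat n hn, ?_⟩
  have hconst : ((f n).toNat : ℚ) - r.eval (n : ℚ) = (f N).toNat - r.eval (N : ℚ) := by
    induction n, hn using Nat.le_induction with
    | base => rfl
    | succ n hn ih => rw [← ih, Nat.cast_add_one, hstep n hn]
  rw [Polynomial.eval_add, Polynomial.eval_C, ← hconst]
  ring

end IsEventuallyPolynomial

section RelLength

variable {R T : Type*} [CommRing R] [AddCommGroup T] [Module R T]

/-- The length of the image of `A` in `T ⧸ B`, i.e. of `(A + B) / B`. -/
noncomputable def relLength (A B : Submodule R T) : ℕ∞ :=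
  Module.length R ↥(A.map B.mkQ)

theorem relLength_eq_of_map_eq {A A' B : Submodule R T} (h : A.map B.mkQ = A'.map B.mkQ) :
    relLength A B = relLength A' B := by
  rw [relLength, relLength, h]

theorem relLength_sup_of_le {A B C : Submodule R T} (h : C ≤ B) :
    relLength (C ⊔ A) B = relLength A B := by
  apply relLength_eq_of_map_eq
  have : C.map B.mkQ = ⊥ := by rwa [← le_bot_iff, Submodule.map_le_iff_le_comap,
    Submodule.comap_bot, Submodule.ker_mkQ]
  rw [Submodule.map_sup, this, bot_sup_eq]

theorem relLength_sup_left (A B : Submodule R T) : relLength (B ⊔ A) B = relLength A B :=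
  relLength_sup_of_le le_rfl

theorem relLength_eq_zero {A B : Submodule R T} (h : A ≤ B) : relLength A B = 0 := by
  have : A.map B.mkQ = ⊥ := by rwa [← le_bot_iff, Submodule.map_le_iff_le_comap,
    Submodule.comap_bot, Submodule.ker_mkQ]
  rw [relLength, this, Module.length_bot]

theorem relLength_eq_length_quotient (A B : Submodule R T) :
    relLength A B = Module.length R (A ⧸ B.submoduleOf A) := by
  have hk : LinearMap.ker (B.mkQ.domRestrict A) = B.submoduleOf A := by
    ext x
    simp [Submodule.submoduleOf]
  have hr : LinearMap.range (B.mkQ.domRestrict A) = A.map B.mkQ :=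
    LinearMap.range_domRestrict A B.mkQ
  rw [relLength, ← hr, ← hk]
  exact (B.mkQ.domRestrict A).quotKerEquivRange.length_eq.symm

theorem relLength_inf_left (A B : Submodule R T) : relLength A (A ⊓ B) = relLength A B := by
  rw [relLength_eq_length_quotient, relLength_eq_length_quotient]
  congr! 2
  all_goals (ext x; simp [Submodule.submoduleOf])

theorem relLength_comap (f : T →ₗ[R] T) (A B : Submodule R T) :
    relLength A (B.comap f) = relLength (A.map f) B := by
  let g : (T ⧸ B.comap f) →ₗ[R] T ⧸ B := (B.comap f).mapQ B f le_rfl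
  have hg : Function.Injective g := by
    rw [← LinearMap.ker_eq_bot, Submodule.ker_mapQ, Submodule.mkQ_map_self]
  have h : (A.map (B.comap f).mkQ).map g = (A.map f).map B.mkQ := by
    rw [← Submodule.map_comp, ← Submodule.map_comp]
    rfl
  rw [relLength, relLength, ← h]
  exact (Submodule.equivMapOfInjective g hg _).length_eq

theorem relLength_eq_add {A B C : Submodule R T} (hBC : B ≤ C) (hCA : C ≤ A) :
    relLength A B = relLength C B + relLength A C := by
  have hle : C.map B.mkQ ≤ A.map B.mkQ := Submodule.map_mono hCA
  let g : (T ⧸ B) →ₗ[R] T ⧸ C := B.mapQ C LinearMap.id hBC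
  have hg : (A.map B.mkQ).map g = A.map C.mkQ := by
    rw [← Submodule.map_comp]
    rfl
  have hker : LinearMap.ker g = C.map B.mkQ := by
    rw [Submodule.ker_mapQ, Submodule.comap_id]
  have hex : relLength A B = Module.length R ↥(C.map B.mkQ) +
      Module.length R (LinearMap.range (g.domRestrict (A.map B.mkQ))) := by
    refine Module.length_eq_add_of_exact (Submodule.inclusion hle)
      (g.domRestrict (A.map B.mkQ)).rangeRestrict (Submodule.inclusion_injective hle)
      (LinearMap.surjective_rangeRestrict _) ?_
    rw [LinearMap.exact_iff, LinearMap.ker_rangeRestrict, Submodule.range_inclusion]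
    ext x
    rw [Submodule.mem_comap, ← hker]
    simp
  rw [hex, LinearMap.range_domRestrict, hg]
  rfl

theorem relLength_mono_left {A A' B : Submodule R T} (h : A ≤ A') :
    relLength A B ≤ relLength A' B := by
  rw [← relLength_sup_left A, ← relLength_sup_left A', relLength_eq_add le_sup_left
    (sup_le_sup_left h B)]
  exact le_self_add

theorem relLength_anti_right {A B B' : Submodule R T} (h : B ≤ B') :
    relLength A B' ≤ relLength A B := by
  rw [← relLength_inf_left A B, ← relLength_inf_left A B',
    relLength_eq_add (inf_le_inf_left A h) inf_le_left]
  exact le_add_self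

end RelLength

section Graded

variable {R T : Type*} [CommRing R] [AddCommGroup T] [Module R T]

/-- Multiplication by each element of `S` maps the `n`-th submodule of the family into the
`(n + 1)`-st. -/
def IsSMulClosed (S : Set R) (N : ℕ → Submodule R T) : Prop :=
  ∀ x ∈ S, ∀ n, ∀ m ∈ N n, x • m ∈ N (n + 1)

/-- The ascending chain condition for the graded submodules of `⨁ n, A n / B n`, where the elements
of `S` act with degree one. -/
def GradedACC (S : Set R) (A B : ℕ → Submodule R T) : Prop :=
  ∀ f : ℕ →o (ℕ → Submodule R T), (∀ k, B ≤ f k ∧ f k ≤ A ∧ IsSMulClosed S (f k)) →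
    ∃ k, ∀ m ≥ k, f k = f m

theorem GradedACC.mono {S S' : Set R} {A A' B B' : ℕ → Submodule R T} (h : GradedACC S A B)
    (hA : A' ≤ A) (hB : B ≤ B')
    (hS : ∀ N, B' ≤ N → N ≤ A' → IsSMulClosed S' N → IsSMulClosed S N) :
    GradedACC S' A' B' := fun f hf =>
  h f fun k => ⟨hB.trans (hf k).1, (hf k).2.1.trans hA, hS _ (hf k).1 (hf k).2.1 (hf k).2.2⟩

theorem GradedACC.eventually_le {A B : ℕ → Submodule R T} (h : GradedACC ∅ A B) (hBA : B ≤ A) :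
    ∀ᶠ n in atTop, A n ≤ B n := by
  let f : ℕ →o (ℕ → Submodule R T) :=
    { toFun := fun k n => if n < k then A n else B n
      monotone' := fun k l hkl n => by
        dsimp only
        split_ifs with h₁ h₂
        · exact le_rfl
        · lia
        · exact hBA n
        · exact le_rfl }
  obtain ⟨k, hk⟩ := h f fun k => by
    refine ⟨fun n => ?_, fun n => ?_, by simp [IsSMulClosed]⟩
    · change B n ≤ if n < k then A n else B n
      split_ifs
      exacts [hBA n, le_rfl]
    · change (if n < k then A n else B n) ≤ A n
      split_ifs
      exacts [le_rfl, hBA n]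
  refine eventually_atTop.mpr ⟨k, fun n hn => ?_⟩
  have : (if n < k then A n else B n) = if n < n + 1 then A n else B n :=
    congrFun (hk (n + 1) (by lia)) n
  rw [if_neg (by lia), if_pos (by lia)] at this
  exact this.ge

theorem isEventuallyPolynomial_relLength_of_gradedACC (S : Finset R) (A B : ℕ → Submodule R T)
    (hBA : B ≤ A) (hA : IsSMulClosed (S : Set R) A) (hB : IsSMulClosed (S : Set R) B)
    (hacc : GradedACC (S : Set R) A B) (hfin : ∀ᶠ n in atTop, relLength (A n) (B n) ≠ ⊤) :
    IsEventuallyPolynomial fun n => relLength (A n) (B n) := by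
  classical
  induction S using Finset.induction_on generalizing A B with
  | empty =>
    rw [Finset.coe_empty] at hacc
    refine IsEventuallyPolynomial.zero.congr ?_
    filter_upwards [hacc.eventually_le hBA] with n hn
    exact (relLength_eq_zero hn).symm
  | insert x S _ ih =>
    have hxS : x ∈ ((insert x S : Finset R) : Set R) := by simp
    have hSS : ∀ y ∈ (S : Set R), y ∈ ((insert x S : Finset R) : Set R) := fun y hy => by
      rw [Finset.coe_insert]
      exact Set.mem_insert_of_mem x hy
    have closed_insert : ∀ N : ℕ → Submodule R T, IsSMulClosed (S : Set R) N →
        (∀ n, ∀ m ∈ N n, x • m ∈ N (n + 1)) →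
        IsSMulClosed ((insert x S : Finset R) : Set R) N := by
      intro N hN hx y hy
      rw [Finset.coe_insert] at hy
      rcases hy with rfl | hy
      exacts [hx, hN y hy]
    let μ : T →ₗ[R] T := LinearMap.lsmul R T x
    let K : ℕ → Submodule R T := fun n => A n ⊓ (B (n + 1)).comap μ
    let C : ℕ → Submodule R T := fun n => Nat.casesOn n (B 0) fun n => B (n + 1) ⊔ (A n).map μ
    have hμA : ∀ n, (A n).map μ ≤ A (n + 1) := by
      rintro n _ ⟨m, hm, rfl⟩
      exact hA x hxS n m hm
    have hBK : B ≤ K := fun n => le_inf (hBA n) fun m hm => hB x hxS n m hm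
    have hKA : K ≤ A := fun n => inf_le_left
    have hBC : B ≤ C := fun n => by
      cases n
      exacts [le_rfl, le_sup_left]
    have hCA : C ≤ A := fun n => by
      cases n
      exacts [hBA 0, sup_le (hBA _) (hμA _)]
    have hμC : ∀ n, ∀ m ∈ A n, x • m ∈ C (n + 1) := fun n m hm =>
      Submodule.mem_sup_right (Submodule.mem_map_of_mem (f := μ) hm)
    have hKpoly : IsEventuallyPolynomial fun n => relLength (K n) (B n) := by
      refine ih K B hBK ?_ (fun y hy => hB y (hSS y hy)) ?_ ?_
      · rintro y hy n m ⟨hm, hm'⟩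
        refine ⟨hA y (hSS y hy) n m hm, ?_⟩
        have := hB y (hSS y hy) _ _ hm'
        change x • y • m ∈ B (n + 1 + 1)
        rwa [smul_comm]
      · exact hacc.mono hKA le_rfl fun N hBN hNK hN =>
          closed_insert N hN fun n m hm => hBN _ (hNK n hm).2
      · filter_upwards [hfin] with n hn
        exact ne_top_of_le_ne_top hn (relLength_mono_left (hKA n))
    have hCpoly : IsEventuallyPolynomial fun n => relLength (A n) (C n) := by
      refine ih A C hCA (fun y hy => hA y (hSS y hy)) ?_ ?_ ?_
      · intro y hy n m hm
        cases n with
        | zero => exact hBC _ (hB y (hSS y hy) 0 m hm)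
        | succ n =>
          obtain ⟨b, hb, _, ⟨a, ha, rfl⟩, rfl⟩ := Submodule.mem_sup.mp hm
          rw [smul_add]
          refine add_mem (hBC _ (hB y (hSS y hy) _ b hb)) ?_
          change y • x • a ∈ C (n + 1 + 1)
          rw [smul_comm]
          exact hμC _ _ (hA y (hSS y hy) _ _ ha)
      · exact hacc.mono le_rfl hBC fun N hCN hNA hN =>
          closed_insert N hN fun n m hm => hCN _ (hμC n m (hNA n hm))
      · filter_upwards [hfin] with n hn
        exact ne_top_of_le_ne_top hn (relLength_anti_right (hBC n))
    refine IsEventuallyPolynomial.of_add_eq_add hfin hCpoly.comp_add_one hKpoly fun n => ?_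
    have e₁ : relLength (A (n + 1)) (B (n + 1)) =
        relLength ((A n).map μ) (B (n + 1)) + relLength (A (n + 1)) (C (n + 1)) := by
      rw [relLength_eq_add (hBC (n + 1)) (hCA (n + 1))]
      congr 1
      exact relLength_sup_left _ _
    have e₂ : relLength (A n) (B n) =
        relLength (K n) (B n) + relLength ((A n).map μ) (B (n + 1)) := by
      rw [relLength_eq_add (hBK n) (hKA n), ← relLength_comap, relLength_inf_left]
    rw [e₁, e₂]
    ring

end Graded

section Rees

variable {R T : Type*} [CommRing R] [AddCommGroup T] [Module R T] {I : Ideal R}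

theorem IsSMulClosed.smul_le {S : Set R} {N : ℕ → Submodule R T} (hN : IsSMulClosed S N)
    (n : ℕ) : Ideal.span S • N n ≤ N (n + 1) := by
  rw [Submodule.span_smul_eq, Submodule.set_smul_le_iff]
  exact fun x m hx hm => hN x hx n m hm

/-- The submodule of the polynomial module over the Rees algebra given by a family `N` of
submodules with `I • N n ≤ N (n + 1)`. -/
noncomputable def reesSubmodule (N : ℕ → Submodule R T) (hN : ∀ n, I • N n ≤ N (n + 1)) :
    Submodule (reesAlgebra I) (PolynomialModule R T) where
  carrier := {f | ∀ i, f.coeff i ∈ N i}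
  add_mem' hf hg i := add_mem (hf i) (hg i)
  zero_mem' _ := zero_mem _
  smul_mem' r f hf i := by
    have pow_smul_le : ∀ j k, I ^ j • N k ≤ N (j + k) := by
      intro j k
      induction j with
      | zero => simp
      | succ j ih =>
        rw [pow_succ', mul_smul, add_right_comm]
        exact (smul_mono_right _ ih).trans (hN _)
    rw [Subalgebra.smul_def, PolynomialModule.smul_apply]
    refine Submodule.sum_mem _ fun jk hjk => ?_
    have hjk : jk.1 + jk.2 = i := by simpa using hjk
    rw [← hjk]
    exact pow_smul_le _ _ (Submodule.smul_mem_smul (r.2 _) (hf _))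

theorem le_of_reesSubmodule_le {N N' : ℕ → Submodule R T} {hN : ∀ n, I • N n ≤ N (n + 1)}
    {hN' : ∀ n, I • N' n ≤ N' (n + 1)} (h : reesSubmodule N hN ≤ reesSubmodule N' hN') :
    N ≤ N' := by
  intro n m hm
  have hmem : PolynomialModule.single R n m ∈ reesSubmodule N hN := by
    intro i
    rw [PolynomialModule.coeff_single, Finsupp.single_apply]
    split_ifs with hi
    · exact hi ▸ hm
    · exact zero_mem _
  simpa using h hmem n

theorem gradedACC_of_le_pow_smul [IsNoetherianRing R] {S : Set R} {V : Submodule R T} (hV : V.FG)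
    {A B : ℕ → Submodule R T} (hA : ∀ n, A n ≤ Ideal.span S ^ n • V) : GradedACC S A B := by
  intro f hf
  let F := (Ideal.span S).stableFiltration V
  have hfg : F.submodule.FG := by
    rw [F.submodule_fg_iff_stable fun n => ?_]
    · exact Ideal.stableFiltration_stable _ V
    · exact Submodule.FG.smul (IsNoetherian.noetherian _) hV
  have : IsNoetherian (reesAlgebra (Ideal.span S)) F.submodule :=
    isNoetherian_of_fg_of_noetherian _ hfg
  let G : ℕ →o Submodule (reesAlgebra (Ideal.span S)) F.submodule :=
    { toFun := fun k =>
        (reesSubmodule (f k) (hf k).2.2.smul_le).submoduleOf F.submodule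
      monotone' := fun k l hkl p hp i => f.monotone hkl i (hp i) }
  obtain ⟨k, hk⟩ := monotone_stabilizes_iff_noetherian.mpr this G
  refine ⟨k, fun m hm => le_antisymm (f.monotone hm) ?_⟩
  refine le_of_reesSubmodule_le (hN := (hf m).2.2.smul_le) (hN' := (hf k).2.2.smul_le) fun p hp => ?_
  have hpF : p ∈ F.submodule := fun i => hA i ((hf m).2.1 i (hp i))
  have hpG : (⟨p, hpF⟩ : F.submodule) ∈ G m := hp
  rw [← hk m hm] at hpG
  exact hpG

theorem isEventuallyPolynomial_relLength_of_le_pow_smul [IsNoetherianRing R]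
    {V : Submodule R T} (hV : V.FG) {A B : ℕ → Submodule R T} (hAV : ∀ n, A n ≤ I ^ n • V)
    (hBA : B ≤ A) (hA : ∀ n, I • A n ≤ A (n + 1)) (hB : ∀ n, I • B n ≤ B (n + 1))
    (hfin : ∀ᶠ n in atTop, relLength (A n) (B n) ≠ ⊤) :
    IsEventuallyPolynomial fun n => relLength (A n) (B n) := by
  obtain ⟨S, rfl⟩ := IsNoetherian.noetherian I
  exact isEventuallyPolynomial_relLength_of_gradedACC S A B hBA
    (fun x hx n m hm => hA n (Submodule.smul_mem_smul (Submodule.subset_span hx) hm))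
    (fun x hx n m hm => hB n (Submodule.smul_mem_smul (Submodule.subset_span hx) hm))
    (gradedACC_of_le_pow_smul hV hAV) hfin

theorem smul_sup_pow_smul_le (I : Ideal R) (U W : Submodule R T) (n : ℕ) :
    I • (U ⊔ I ^ n • W) ≤ U ⊔ I ^ (n + 1) • W := by
  rw [Submodule.smul_sup, pow_succ', mul_smul]
  exact sup_le_sup_right Submodule.smul_le_right _

theorem smul_inf_le_inf {A A' B B' : Submodule R T} (hA : I • A ≤ A') (hB : I • B ≤ B') :
    I • (A ⊓ B) ≤ A' ⊓ B' :=
  le_inf ((smul_mono_right I inf_le_left).trans hA)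
    ((smul_mono_right I inf_le_right).trans hB)

theorem pow_succ_smul_le_pow_smul (I : Ideal R) (W : Submodule R T) (n : ℕ) :
    I ^ (n + 1) • W ≤ I ^ n • W :=
  Submodule.smul_mono_left (Ideal.pow_le_pow_right n.le_succ)

theorem isEventuallyPolynomial_relLength_pow_smul_sup [IsNoetherianRing R]
    (U W : Submodule R T) {V : Submodule R T} (hV : V.FG)
    (hfin : ∀ᶠ n in atTop, relLength (I ^ n • V) (U ⊔ I ^ n • W) ≠ ⊤) :
    IsEventuallyPolynomial fun n => relLength (I ^ n • V) (U ⊔ I ^ n • W) := by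
  have hV' : ∀ n, I • I ^ n • V ≤ I ^ (n + 1) • V := fun n => by rw [pow_succ', mul_smul]
  have hinf : (fun n => relLength (I ^ n • V) (U ⊔ I ^ n • W)) =
      fun n => relLength (I ^ n • V) (I ^ n • V ⊓ (U ⊔ I ^ n • W)) :=
    funext fun n => (relLength_inf_left _ _).symm
  rw [hinf]
  exact isEventuallyPolynomial_relLength_of_le_pow_smul hV (fun n => le_rfl) (fun n => inf_le_left)
    hV' (fun n => smul_inf_le_inf (hV' n) (smul_sup_pow_smul_le I U W n))
    (hfin.mono fun n hn => by rwa [relLength_inf_left])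

theorem isEventuallyPolynomial_relLength_sup_pow_smul [IsNoetherianRing R]
    {U Z : Submodule R T} (hZU : Z ≤ U) {W : Submodule R T} (hW : W.FG)
    (hfin : ∀ᶠ n in atTop, relLength U (Z ⊔ I ^ n • W) ≠ ⊤) :
    IsEventuallyPolynomial fun n => relLength U (Z ⊔ I ^ n • W) := by
  let A : ℕ → Submodule R T := fun n => U ⊓ I ^ n • W
  have hanti : ∀ n, Z ⊔ I ^ (n + 1) • W ≤ Z ⊔ I ^ n • W := fun n =>
    sup_le_sup_left (pow_succ_smul_le_pow_smul I W n) Z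
  have hA : ∀ n, I • A n ≤ A (n + 1) := fun n =>
    smul_inf_le_inf Submodule.smul_le_right (by rw [pow_succ', mul_smul])
  have hstep : ∀ n, relLength U (Z ⊔ I ^ (n + 1) • W) = relLength U (Z ⊔ I ^ n • W) +
      relLength (A n) (A n ⊓ (Z ⊔ I ^ (n + 1) • W)) := by
    intro n
    have hmod : U ⊓ (Z ⊔ I ^ n • W) = Z ⊔ A n := by
      rw [inf_comm, sup_inf_assoc_of_le _ hZU, inf_comm]
    rw [← relLength_inf_left U, relLength_eq_add (inf_le_inf_left U (hanti n)) inf_le_left,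
      relLength_inf_left U, hmod, relLength_sup_of_le (le_inf hZU le_sup_left), add_comm,
      ← relLength_inf_left (A n), ← inf_assoc, inf_eq_left.mpr (inf_le_left : A n ≤ U)]
  refine IsEventuallyPolynomial.of_add_eq_add hfin
    (isEventuallyPolynomial_relLength_of_le_pow_smul (I := I) hW (A := A)
      (B := fun n => A n ⊓ (Z ⊔ I ^ (n + 1) • W)) (fun n => inf_le_right) (fun n => inf_le_left) hA
      (fun n => smul_inf_le_inf (hA n) (smul_sup_pow_smul_le I Z W (n + 1))) ?_)
    IsEventuallyPolynomial.zero fun n => by simp [hstep n]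
  filter_upwards [(tendsto_add_atTop_nat 1).eventually hfin] with n hn
  refine ne_top_of_le_ne_top hn ?_
  rw [hstep n]
  exact le_add_self

end Rees

/-- Lemma 2(b). Let `R` be a commutative Noetherian ring, `I` an ideal,
`T` an `R`-module, and `U, V, W, Z` finitely generated submodules of `T` with `Z ⊆ U` and
`W ⊆ V`.  Set `Lₙ := (U + IⁿV)/(Z + IⁿW)` (realized as the image of `U + IⁿV` in
`T/(Z + IⁿW)`), and assume `Lₙ` has finite length for all sufficiently large `n`.  Then there
is a polynomial `p ∈ ℚ[X]` with `λ(Lₙ) = p(n)` for all sufficiently large `n`. -/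
theorem stmt_3 {R : Type*} [CommRing R] [IsNoetherianRing R] (I : Ideal R)
    {T : Type*} [AddCommGroup T] [Module R T]
    (U V W Z : Submodule R T) (hU : U.FG) (hV : V.FG) (hW : W.FG) (hZ : Z.FG)
    (hZU : Z ≤ U) (hWV : W ≤ V)
    (hfin : ∃ N : ℕ, ∀ n ≥ N,
      IsFiniteLength R ↥((U ⊔ I ^ n • V).map (Z ⊔ I ^ n • W).mkQ)) :
    ∃ (p : Polynomial ℚ) (N : ℕ), ∀ n ≥ N, ∃ ℓ : ℕ,
      moduleLength R ↥((U ⊔ I ^ n • V).map (Z ⊔ I ^ n • W).mkQ) = ℓ ∧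
      (ℓ : ℚ) = p.eval (n : ℚ) := by
  have hsplit : ∀ n, relLength (U ⊔ I ^ n • V) (Z ⊔ I ^ n • W) =
      relLength U (Z ⊔ I ^ n • W) + relLength (I ^ n • V) (U ⊔ I ^ n • W) := by
    intro n
    have hWV' : I ^ n • W ≤ I ^ n • V := smul_mono_right _ hWV
    rw [relLength_eq_add (sup_le_sup_right hZU _) (sup_le_sup_left hWV' U), sup_comm U (_ • W),
      relLength_sup_of_le le_sup_right, sup_comm (_ • W) U, relLength_sup_of_le le_sup_left]
  have hfin' : ∀ᶠ n in atTop, relLength (U ⊔ I ^ n • V) (Z ⊔ I ^ n • W) ≠ ⊤ :=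
    eventually_atTop.mpr <| hfin.imp fun _ h n hn => Module.length_ne_top_iff.mpr (h n hn)
  have hpoly := (isEventuallyPolynomial_relLength_sup_pow_smul (I := I) hZU hW <| hfin'.mono
    fun n hn => ne_top_of_le_ne_top hn <| (hsplit n).symm ▸ le_self_add).add
    (isEventuallyPolynomial_relLength_pow_smul_sup (I := I) U W hV <| hfin'.mono
    fun n hn => ne_top_of_le_ne_top hn <| (hsplit n).symm ▸ le_add_self)
  obtain ⟨p, hp⟩ := hpoly
  obtain ⟨N, hN⟩ := eventually_atTop.mp hp
  refine ⟨p, N, fun n hn => ?_⟩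
  obtain ⟨l, hl, hlp⟩ := hN n hn
  refine ⟨l, ?_, hlp⟩
  rw [moduleLength, ← Module.coe_length]
  change ((relLength (U ⊔ I ^ n • V) (Z ⊔ I ^ n • W) : ℕ∞) : WithBot ℕ∞) = _
  rw [hsplit n]
  exact congrArg _ hl
end

section
/- Let R be a commutative Noetherian ring, I an ideal, N a finitely generated R-module, and let C : F_2 →^ψ F_1 →^φ F_0 be a complex of R-modules (so φ ∘ ψ = 0) with F_0 and F_1 finitely generated. If the homology module H_1(C ⊗ N/I^n N) = ker(φ ⊗ id)/im(ψ ⊗ id) has finite length for all sufficiently large n, then there exists a polynomial p with rational coefficients such that λ(H_1(C ⊗ N/I^n N)) = p(n) for all sufficiently large n. -/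
/-- For a complex `C : F₂ →ψ F₁ →φ F₀` of `R`-modules and an `R`-module `L`, the homology
`H₁(C ⊗ L) := ker (φ ⊗ id_L) / im (ψ ⊗ id_L)` at the middle spot of `F₂ ⊗ L → F₁ ⊗ L → F₀ ⊗ L`. -/
abbrev homologyOne {R F₀ F₁ F₂ : Type*} [CommRing R]
    [AddCommGroup F₀] [Module R F₀] [AddCommGroup F₁] [Module R F₁]
    [AddCommGroup F₂] [Module R F₂]
    (ψ : F₂ →ₗ[R] F₁) (φ : F₁ →ₗ[R] F₀) (L : Type*) [AddCommGroup L] [Module R L] :=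
  ↥(LinearMap.ker (φ.rTensor L)) ⧸
    (Submodule.comap (LinearMap.ker (φ.rTensor L)).subtype (LinearMap.range (ψ.rTensor L)))

open Polynomial in
/-- The values of `f` are eventually finite and agree with those of a rational polynomial. -/
def EventuallyPolynomial (f : ℕ → ℕ∞) : Prop :=
  ∃ (p : ℚ[X]) (N₀ : ℕ), ∀ n ≥ N₀, ∃ ℓ : ℕ, f n = ℓ ∧ (ℓ : ℚ) = p.eval (n : ℚ)

theorem exists_polynomial_eval_succ_sub (q : Polynomial ℚ) :
    ∃ Q : Polynomial ℚ, ∀ x : ℚ, Q.eval (x + 1) = Q.eval x + q.eval x := by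
  induction q using Polynomial.induction_on' with
  | add p q hp hq =>
    obtain ⟨P, hP⟩ := hp
    obtain ⟨Q, hQ⟩ := hq
    refine ⟨P + Q, fun x => ?_⟩
    simp only [Polynomial.eval_add, hP, hQ]
    ring
  | monomial n a =>
    refine ⟨Polynomial.C (a / (n + 1)) * Polynomial.bernoulli (n + 1), fun x => ?_⟩
    have hn : (n : ℚ) + 1 ≠ 0 := by positivity
    simp only [Polynomial.eval_mul, Polynomial.eval_C, Polynomial.eval_monomial, add_comm x 1,
      Polynomial.bernoulli_eval_one_add]
    push_cast
    field_simp

namespace EventuallyPolynomial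

theorem zero : EventuallyPolynomial 0 := ⟨0, 0, fun _ _ => ⟨0, by simp⟩⟩

theorem congr {f g : ℕ → ℕ∞} (hf : EventuallyPolynomial f) (N : ℕ) (h : ∀ n ≥ N, g n = f n) :
    EventuallyPolynomial g := by
  obtain ⟨p, N₁, hp⟩ := hf
  refine ⟨p, max N N₁, fun n hn => ?_⟩
  rw [h n (le_of_max_le_left hn)]
  exact hp n (le_of_max_le_right hn)

theorem add {f g : ℕ → ℕ∞} (hf : EventuallyPolynomial f) (hg : EventuallyPolynomial g) :
    EventuallyPolynomial fun n => f n + g n := by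
  obtain ⟨p, N₁, hp⟩ := hf
  obtain ⟨q, N₂, hq⟩ := hg
  refine ⟨p + q, max N₁ N₂, fun n hn => ?_⟩
  obtain ⟨a, ha, ha'⟩ := hp n (le_of_max_le_left hn)
  obtain ⟨b, hb, hb'⟩ := hq n (le_of_max_le_right hn)
  exact ⟨a + b, by simp [ha, hb], by simp [ha', hb']⟩

/-- A function whose successive differences are eventually polynomial is eventually polynomial. -/
theorem of_succ_add_eq {h k c : ℕ → ℕ∞} (N : ℕ) (hh : ∀ n ≥ N, h n ≠ ⊤)
    (hk : EventuallyPolynomial k) (hc : EventuallyPolynomial c)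
    (H : ∀ n ≥ N, h (n + 1) + k n = h n + c n) : EventuallyPolynomial h := by
  obtain ⟨p, N₁, hp⟩ := hk
  obtain ⟨q, N₂, hq⟩ := hc
  obtain ⟨Q, hQ⟩ := exists_polynomial_eval_succ_sub (q - p)
  set M := max N (max N₁ N₂)
  refine ⟨Q + Polynomial.C ((h M).toNat - Q.eval (M : ℚ)), M, fun n hn => ?_⟩
  have hfin : ∀ n ≥ M, h n = ((h n).toNat : ℕ∞) := fun n hn =>
    (ENat.natCast_toNat (hh n (by omega))).symm
  refine ⟨(h n).toNat, hfin n hn, ?_⟩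
  induction n, hn using Nat.le_induction with
  | base => simp
  | succ n hn ih =>
    obtain ⟨a, ha, ha'⟩ := hp n (by omega)
    obtain ⟨b, hb, hb'⟩ := hq n (by omega)
    have e := H n (by omega)
    rw [ha, hb, hfin n hn, hfin (n + 1) (by omega)] at e
    have e' : (((h (n + 1)).toNat + a : ℕ) : ℚ) = ((h n).toNat + b : ℕ) := by
      exact_mod_cast e
    push_cast at e'
    have := hQ n
    simp only [Polynomial.eval_add, Polynomial.eval_C, Polynomial.eval_sub] at *
    push_cast
    rw [this]
    linarith

end EventuallyPolynomial

namespace Submodule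

section RelLength

variable {R E E' : Type*} [CommRing R] [AddCommGroup E] [Module R E] [AddCommGroup E'] [Module R E']

/-- The length of the subquotient `A / (A ⊓ B)`. -/
noncomputable def relLength (B A : Submodule R E) : ℕ∞ :=
  Module.length R (A ⧸ B.submoduleOf A)

theorem relLength_add {C B A : Submodule R E} (hCB : C ≤ B) (hBA : B ≤ A) :
    relLength C A = relLength C B + relLength B A := by
  refine Module.length_eq_add_of_exact
    (mapQ (C.submoduleOf B) (C.submoduleOf A) (inclusion hBA) fun _ h => h)
    (mapQ (C.submoduleOf A) (B.submoduleOf A) LinearMap.id fun _ h => hCB h) ?_ ?_ ?_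
  · rw [← LinearMap.ker_eq_bot, LinearMap.ker_eq_bot']
    rintro ⟨x⟩ hx
    exact (Quotient.mk_eq_zero _).2 ((Quotient.mk_eq_zero (C.submoduleOf A)).1 hx :)
  · rintro ⟨x⟩
    exact ⟨Quotient.mk x, rfl⟩
  · rintro ⟨x⟩
    constructor
    · intro hx
      have hx' : (x : E) ∈ B := ((Quotient.mk_eq_zero (B.submoduleOf A)).1 hx :)
      exact ⟨Quotient.mk ⟨x, hx'⟩, rfl⟩
    · rintro ⟨⟨y⟩, hy⟩
      change Quotient.mk (inclusion hBA y) = Quotient.mk x at hy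
      rw [Quotient.eq] at hy
      refine (Quotient.mk_eq_zero (B.submoduleOf A)).2 ?_
      have h1 : (y : E) - x ∈ C := hy
      have h2 := B.sub_mem y.2 (hCB h1)
      rwa [sub_sub_cancel] at h2

theorem relLength_eq_of_linearMap (T : E →ₗ[R] E') {B A : Submodule R E} {B' A' : Submodule R E'}
    (hA : A ≤ A'.comap T) (hB : ∀ x ∈ A, T x ∈ B' ↔ x ∈ B) (hA' : A' ≤ B' ⊔ A.map T) :
    relLength B A = relLength B' A' := by
  let f : A →ₗ[R] A' ⧸ B'.submoduleOf A' := (B'.submoduleOf A').mkQ ∘ₗ T.restrict hA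
  have hker : LinearMap.ker f = B.submoduleOf A := by
    ext x
    rw [LinearMap.mem_ker]
    change (B'.submoduleOf A').mkQ _ = 0 ↔ _
    rw [mkQ_apply, Quotient.mk_eq_zero]
    exact hB x x.2
  have hf : Function.Surjective f := by
    rintro ⟨y⟩
    obtain ⟨b, hb, _, ⟨x, hx, rfl⟩, hy⟩ := mem_sup.1 (hA' y.2)
    refine ⟨⟨x, hx⟩, (Quotient.eq _).2 ?_⟩
    have : T x - (y : E') ∈ B' := by
      rw [← hy, sub_add_cancel_right]
      exact B'.neg_mem hb
    exact this
  exact ((quotEquivOfEq _ _ hker).symm.trans (f.quotKerEquivOfSurjective hf)).length_eq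

theorem relLength_inf (B A : Submodule R E) : relLength (A ⊓ B) A = relLength B (B ⊔ A) :=
  relLength_eq_of_linearMap LinearMap.id (fun _ hx => mem_sup_right hx)
    (fun x hx => by simp [hx]) (by simp)

end RelLength

section Hilbert

variable {R E : Type*} [CommRing R] [AddCommGroup E] [Module R E]

/-- Every graded submodule of the graded module `⨁ A n / B n`, on which the elements of `J` act as
operators of degree one, is generated over these operators in bounded degrees. -/
def EventuallyGenerated (J : Ideal R) (A B : ℕ → Submodule R E) : Prop :=
  ∀ V : ℕ → Submodule R E, (∀ n, B n ≤ V n) → (∀ n, V n ≤ A n) → (∀ n, J • V n ≤ V (n + 1)) →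
    ∃ n₀, ∀ n ≥ n₀, V (n + 1) ≤ B (n + 1) ⊔ J • V n

theorem EventuallyGenerated.shift {J : Ideal R} {A B : ℕ → Submodule R E}
    (h : EventuallyGenerated J A B) (hBA : B 0 ≤ A 0) (hB : J • B 0 ≤ B 1) :
    EventuallyGenerated J (fun n => A (n + 1)) (fun n => B (n + 1)) := by
  intro V hBV hVA hV
  obtain ⟨n₀, hn₀⟩ := h (fun n => n.casesOn (B 0) V)
    (by rintro (_ | n); exacts [le_rfl, hBV n]) (by rintro (_ | n); exacts [hBA, hVA n])
    (by rintro (_ | n); exacts [hB.trans (hBV 0), hV n])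
  exact ⟨n₀, fun n hn => hn₀ (n + 1) (by omega)⟩

theorem EventuallyGenerated.eventuallyPolynomial {J : Ideal R} (hJ : J.FG)
    {A B : ℕ → Submodule R E} (hBA : ∀ n, B n ≤ A n) (hA : ∀ n, J • A n ≤ A (n + 1))
    (hB : ∀ n, J • B n ≤ B (n + 1)) (h : EventuallyGenerated J A B) (N : ℕ)
    (hfin : ∀ n ≥ N, relLength (B n) (A n) ≠ ⊤) :
    EventuallyPolynomial fun n => relLength (B n) (A n) := by
  classical
  obtain ⟨s, rfl⟩ := hJ
  induction s using Finset.induction_on generalizing A B N with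
  | empty =>
    obtain ⟨n₀, hn₀⟩ := h A hBA (fun _ => le_rfl) hA
    refine EventuallyPolynomial.zero.congr (n₀ + 1) fun n hn => ?_
    obtain ⟨n, rfl⟩ : ∃ m, n = m + 1 := ⟨n - 1, by omega⟩
    have := hn₀ n (by omega)
    simp only [Finset.coe_empty, span_empty, bot_smul, sup_bot_eq] at this
    have : Subsingleton (A (n + 1) ⧸ (B (n + 1)).submoduleOf (A (n + 1))) := by
      rw [Submodule.Quotient.subsingleton_iff, submoduleOf_eq_top]
      exact this
    exact Module.length_eq_zero
  | insert a t _ ih =>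
    have hspan (V : Submodule R E) : span R ((insert a t : Finset R) : Set R) • V =
        V.map (LinearMap.lsmul R E a) ⊔ span R (t : Set R) • V := by
      rw [Finset.coe_insert, span_insert, sup_smul, ideal_span_singleton_smul]
      rfl
    simp only [hspan, sup_le_iff] at hA hB
    let K : ℕ → Submodule R E := fun n => A n ⊓ (B (n + 1)).comap (LinearMap.lsmul R E a)
    let C : ℕ → Submodule R E := fun n => B (n + 1) ⊔ (A n).map (LinearMap.lsmul R E a)
    have hBK (n) : B n ≤ K n := le_inf (hBA n) (map_le_iff_le_comap.1 (hB n).1)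
    have hCA (n) : C n ≤ A (n + 1) := sup_le (hBA _) (hA n).1
    have e₁ (n) : relLength (B n) (A n) = relLength (B n) (K n) + relLength (K n) (A n) :=
      relLength_add (hBK n) inf_le_left
    have e₂ (n) : relLength (B (n + 1)) (A (n + 1)) =
        relLength (B (n + 1)) (C n) + relLength (C n) (A (n + 1)) :=
      relLength_add le_sup_left (hCA n)
    have e₃ (n) : relLength (K n) (A n) = relLength (B (n + 1)) (C n) :=
      relLength_eq_of_linearMap (LinearMap.lsmul R E a)
        (map_le_iff_le_comap.1 le_sup_right) (fun x hx => by simp [K, hx]) le_rfl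
    have hK : EventuallyPolynomial fun n => relLength (B n) (K n) := by
      refine ih hBK N (fun n hn H => hfin n hn (by rw [e₁, H, top_add])) (fun n => ?_)
        (fun n => (hB n).2) fun V hBV hVK hV => ?_
      · refine le_inf ((smul_mono_right _ inf_le_left).trans (hA n).2) ?_
        rw [← map_le_iff_le_comap, map_smul'']
        refine (smul_mono_right _ ?_).trans (hB (n + 1)).2
        exact map_le_iff_le_comap.2 inf_le_right
      · have key (n) : (V n).map (LinearMap.lsmul R E a) ≤ B (n + 1) :=
          map_le_iff_le_comap.2 ((hVK n).trans inf_le_right)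
        obtain ⟨n₀, hn₀⟩ := h V hBV (fun n => (hVK n).trans inf_le_left) fun n => by
          rw [hspan]
          exact sup_le ((key n).trans (hBV _)) (hV n)
        refine ⟨n₀, fun n hn => (hn₀ n hn).trans ?_⟩
        rw [hspan]
        exact sup_le le_sup_left (sup_le ((key n).trans le_sup_left) le_sup_right)
    have hC : EventuallyPolynomial fun n => relLength (C n) (A (n + 1)) := by
      refine ih hCA N (fun n hn H => hfin (n + 1) (by omega) (by rw [e₂, H, add_top]))
        (fun n => (hA _).2) (fun n => ?_) fun V hCV hVA hV => ?_
      · rw [smul_sup, ← map_smul'']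
        exact sup_le_sup (hB _).2 (map_mono (hA n).2)
      · have key (n) : (V n).map (LinearMap.lsmul R E a) ≤ C (n + 1) :=
          (map_mono (hVA n)).trans le_sup_right
        obtain ⟨n₀, hn₀⟩ := h.shift (hBA 0) (by rw [hspan]; exact sup_le (hB 0).1 (hB 0).2) V
          (fun n => le_sup_left.trans (hCV n)) hVA fun n => by
            rw [hspan]
            exact sup_le ((key n).trans (hCV _)) (hV n)
        refine ⟨n₀, fun n hn => (hn₀ n hn).trans ?_⟩
        rw [hspan]
        exact sup_le (le_sup_left.trans le_sup_left)
          (sup_le ((key n).trans le_sup_left) le_sup_right)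
    refine .of_succ_add_eq N hfin hK hC fun n _ => ?_
    rw [e₁ n, e₂ n, e₃ n]
    ring

end Hilbert

section Rees

variable {R E : Type*} [CommRing R] [AddCommGroup E] [Module R E]

/-- The submodule of `E[X]` over the Rees algebra of `I` associated with a sequence of submodules
that is compatible with multiplication by the powers of `I`. -/
noncomputable def reesSubmodule (I : Ideal R) (G : ℕ → Submodule R E)
    (hG : ∀ i j, I ^ i • G j ≤ G (i + j)) :
    Submodule (reesAlgebra I) (PolynomialModule R E) where
  carrier := { f | ∀ i, f.coeff i ∈ G i }
  add_mem' hf hg i := add_mem (hf i) (hg i)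
  zero_mem' _ := Submodule.zero_mem _
  smul_mem' r f hf i := by
    rw [Subalgebra.smul_def, PolynomialModule.smul_apply]
    refine sum_mem ?_
    rintro ⟨j, k⟩ e
    obtain rfl : j + k = i := Finset.HasAntidiagonal.mem_antidiagonal.1 e
    exact hG j k (smul_mem_smul (r.2 j) (hf k))

theorem exists_le_smul_of_le_pow_smul [IsNoetherianRing R] [Module.Finite R E] (I : Ideal R)
    (W : ℕ → Submodule R E) (hW : ∀ n, W n ≤ I ^ n • ⊤) (hIW : ∀ n, I • W n ≤ W (n + 1)) :
    ∃ n₀, ∀ n ≥ n₀, W (n + 1) ≤ I • W n := by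
  have hpow (i j) : I ^ i • W j ≤ W (i + j) := by
    induction i with
    | zero => simp
    | succ i ih =>
      rw [pow_succ', ← smul_eq_mul, Submodule.smul_assoc, show i + 1 + j = i + j + 1 by omega]
      exact (smul_mono_right _ ih).trans (hIW _)
  have hnoeth : IsNoetherian (reesAlgebra I) (I.stableFiltration (⊤ : Submodule R E)).submodule :=
    isNoetherian_of_fg_of_noetherian _ <|
      (Ideal.Filtration.submodule_fg_iff_stable _ fun _ => IsNoetherian.noetherian _).2
        (I.stableFiltration_stable ⊤)
  let G (k i : ℕ) : Submodule R E := I ^ (i - k) • W (min i k)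
  have hG (k i j) : I ^ i • G k j ≤ G k (i + j) := by
    change I ^ i • I ^ (j - k) • W (min j k) ≤ I ^ (i + j - k) • W (min (i + j) k)
    rw [← Submodule.smul_assoc, smul_eq_mul, ← pow_add]
    rcases le_total k j with hkj | hjk
    · rw [min_eq_right hkj, min_eq_right (by omega), show i + j - k = i + (j - k) by omega]
    · rw [min_eq_left hjk, show i + (j - k) = (i + j - k) + (min (i + j) k - j) by omega, pow_add,
        ← smul_eq_mul, Submodule.smul_assoc]
      refine smul_mono_right _ ((hpow _ _).trans_eq ?_)
      congr 1
      omega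
  have hGW (k i) : G k i ≤ W i := (hpow _ _).trans_eq (by congr 1; omega)
  have hGmono (k i) : G k i ≤ G (k + 1) i := by
    change I ^ (i - k) • W (min i k) ≤ I ^ (i - (k + 1)) • W (min i (k + 1))
    rcases le_or_gt i k with hik | hki
    · rw [min_eq_left hik, min_eq_left (by omega), Nat.sub_eq_zero_of_le hik,
        Nat.sub_eq_zero_of_le (by omega)]
    · rw [min_eq_right hki.le, min_eq_right (by omega),
        show i - k = i - (k + 1) + 1 by omega, pow_succ, ← smul_eq_mul, Submodule.smul_assoc]
      exact smul_mono_right _ (hIW k)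
  let S : ℕ →o Submodule (reesAlgebra I) (I.stableFiltration (⊤ : Submodule R E)).submodule :=
    ⟨fun k => (reesSubmodule I (G k) (hG k)).submoduleOf _,
      monotone_nat_of_le_succ fun k _ hf i => hGmono k i (hf i)⟩
  obtain ⟨n₀, hn₀⟩ := monotone_stabilizes_iff_noetherian.2 hnoeth S
  refine ⟨n₀, fun n hn x hx => ?_⟩
  have hS : S (n + 1) = S n := (hn₀ _ (by omega)).symm.trans (hn₀ _ hn)
  have hsingle (G : ℕ → Submodule R E) (hx : x ∈ G (n + 1)) (i) :
      (PolynomialModule.single R (n + 1) x).coeff i ∈ G i := by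
    rw [PolynomialModule.coeff_single, Finsupp.single_apply]
    split_ifs with hi
    · rwa [← hi]
    · exact Submodule.zero_mem _
  let f : (I.stableFiltration (⊤ : Submodule R E)).submodule :=
    ⟨PolynomialModule.single R (n + 1) x,
      hsingle (fun i => I ^ i • ⊤) (hW _ hx)⟩
  have hf : f ∈ S (n + 1) := hsingle (G (n + 1)) (by simpa [G] using hx)
  rw [hS] at hf
  have hf' : (PolynomialModule.single R (n + 1) x).coeff (n + 1) ∈ G n (n + 1) := hf (n + 1)
  simpa [G] using hf'

theorem eventuallyGenerated_of_le_sup [IsNoetherianRing R] [Module.Finite R E] (I : Ideal R)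
    {A B : ℕ → Submodule R E} (h : ∀ n, A n ≤ B n ⊔ I ^ n • ⊤) : EventuallyGenerated I A B := by
  intro V hBV hVA hV
  obtain ⟨n₀, hn₀⟩ := exists_le_smul_of_le_pow_smul I (fun n => V n ⊓ I ^ n • ⊤)
    (fun _ => inf_le_right) fun n => by
      refine le_inf ((smul_mono_right _ inf_le_left).trans (hV n)) ?_
      rw [pow_succ', ← smul_eq_mul, Submodule.smul_assoc]
      exact smul_mono_right _ inf_le_right
  refine ⟨n₀, fun n hn => ?_⟩
  calc V (n + 1) ≤ (B (n + 1) ⊔ I ^ (n + 1) • ⊤) ⊓ V (n + 1) :=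
        le_inf ((hVA _).trans (h _)) le_rfl
    _ = B (n + 1) ⊔ V (n + 1) ⊓ I ^ (n + 1) • ⊤ := by
        rw [sup_inf_assoc_of_le _ (hBV _), inf_comm (V (n + 1))]
    _ ≤ B (n + 1) ⊔ I • V n :=
        sup_le_sup_left ((hn₀ n hn).trans (smul_mono_right _ inf_le_left)) _

end Rees

section Preimage

variable {R E E' : Type*} [CommRing R] [IsNoetherianRing R] [AddCommGroup E] [Module R E]
  [AddCommGroup E'] [Module R E']

theorem eventuallyPolynomial_relLength_inf [Module.Finite R E] (I : Ideal R)
    {G K : Submodule R E} (hGK : G ≤ K) (N : ℕ)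
    (hfin : ∀ n ≥ N, relLength (G ⊔ K ⊓ I ^ n • ⊤) K ≠ ⊤) :
    EventuallyPolynomial fun n => relLength (G ⊔ K ⊓ I ^ n • ⊤) K := by
  have hI (n : ℕ) : I • (G ⊔ K ⊓ I ^ n • ⊤) ≤ G ⊔ K ⊓ I ^ (n + 1) • ⊤ := by
    rw [smul_sup]
    refine sup_le_sup smul_le_right (le_inf (smul_le_right.trans inf_le_left) ?_)
    rw [pow_succ', ← smul_eq_mul, Submodule.smul_assoc]
    exact smul_mono_right _ inf_le_right
  have hanti (n : ℕ) : G ⊔ K ⊓ I ^ (n + 1) • ⊤ ≤ G ⊔ K ⊓ I ^ n • ⊤ :=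
    sup_le_sup_left (inf_le_inf_left _ (smul_mono_left (Ideal.pow_le_pow_right n.le_succ))) _
  have hadd (n : ℕ) := relLength_add (hanti n) (sup_le hGK (inf_le_left (b := I ^ n • ⊤)))
  refine .of_succ_add_eq N hfin .zero
    (EventuallyGenerated.eventuallyPolynomial (IsNoetherian.noetherian I) hanti hI
      (fun n => hI (n + 1)) (eventuallyGenerated_of_le_sup I fun n => ?_) N fun n hn H => ?_)
    fun n _ => ?_
  · exact sup_le (le_sup_left.trans le_sup_left) (inf_le_right.trans le_sup_right)
  · exact hfin (n + 1) (by omega) (by rw [hadd, H, top_add])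
  · rw [hadd, Pi.zero_apply, add_zero, add_comm]

theorem eventuallyPolynomial_relLength_range_inf [Module.Finite R E'] (I : Ideal R)
    (f : E →ₗ[R] E') (N : ℕ)
    (hfin : ∀ n ≥ N, relLength ((I ^ n • ⊤ : Submodule R E).map f)
      (LinearMap.range f ⊓ I ^ n • ⊤) ≠ ⊤) :
    EventuallyPolynomial fun n => relLength ((I ^ n • ⊤ : Submodule R E).map f)
      (LinearMap.range f ⊓ I ^ n • ⊤) := by
  refine EventuallyGenerated.eventuallyPolynomial (IsNoetherian.noetherian I)
    (fun n => le_inf LinearMap.map_le_range ?_)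
    (fun n => le_inf (smul_le_right.trans inf_le_left) ?_) (fun n => ?_)
    (eventuallyGenerated_of_le_sup I fun n => inf_le_right.trans le_sup_right) N hfin
  · rw [map_smul'']
    exact smul_mono_right _ le_top
  · rw [pow_succ', ← smul_eq_mul, Submodule.smul_assoc]
    exact smul_mono_right _ inf_le_right
  · rw [← map_smul'', pow_succ', ← smul_eq_mul, Submodule.smul_assoc]

theorem eventuallyPolynomial_relLength_comap [Module.Finite R E] [Module.Finite R E']
    (I : Ideal R) (f : E →ₗ[R] E') {G : Submodule R E} (hG : G ≤ LinearMap.ker f) (N : ℕ)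
    (hfin : ∀ n ≥ N, relLength (G ⊔ I ^ n • ⊤) ((I ^ n • ⊤ : Submodule R E').comap f) ≠ ⊤) :
    EventuallyPolynomial fun n =>
      relLength (G ⊔ I ^ n • ⊤) ((I ^ n • ⊤ : Submodule R E').comap f) := by
  have hle (n : ℕ) : (I ^ n • ⊤ : Submodule R E) ≤ (I ^ n • ⊤ : Submodule R E').comap f := by
    rw [← map_le_iff_le_comap, map_smul'']
    exact smul_mono_right _ le_top
  have hker (n : ℕ) : LinearMap.ker f ≤ (I ^ n • ⊤ : Submodule R E').comap f :=
    comap_mono bot_le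
  have e₁ (n : ℕ) : relLength (G ⊔ I ^ n • ⊤) (LinearMap.ker f ⊔ I ^ n • ⊤) =
      relLength (G ⊔ LinearMap.ker f ⊓ I ^ n • ⊤) (LinearMap.ker f) := by
    rw [show G ⊔ LinearMap.ker f ⊓ I ^ n • ⊤ = LinearMap.ker f ⊓ (G ⊔ I ^ n • ⊤) by
      rw [inf_comm, inf_comm _ (G ⊔ _), sup_inf_assoc_of_le _ hG], relLength_inf]
    congr 1
    rw [sup_right_comm, sup_eq_right.2 hG]
  have e₂ (n : ℕ) : relLength (LinearMap.ker f ⊔ I ^ n • ⊤)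
      ((I ^ n • ⊤ : Submodule R E').comap f) =
      relLength ((I ^ n • ⊤ : Submodule R E).map f) (LinearMap.range f ⊓ I ^ n • ⊤) := by
    refine relLength_eq_of_linearMap f (fun x hx => ⟨⟨x, rfl⟩, hx⟩) (fun x _ => ?_) ?_
    · rw [← mem_comap, comap_map_eq, sup_comm]
    · rw [map_comap_eq]
      exact le_sup_right
  have hadd (n : ℕ) := relLength_add (sup_le_sup_right hG (I ^ n • ⊤)) (sup_le (hker n) (hle n))
  simp only [e₁, e₂] at hadd
  simp only [hadd]
  refine .add (eventuallyPolynomial_relLength_inf I hG N fun n hn H => ?_)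
    (eventuallyPolynomial_relLength_range_inf I f N fun n hn H => ?_)
  · exact hfin n hn (by rw [hadd, H, top_add])
  · exact hfin n hn (by rw [hadd, H, add_top])

end Preimage

end Submodule

section Tensor

open TensorProduct

variable {R : Type*} [CommRing R]

theorem LinearMap.ker_lTensor_mkQ_smul_top (F N : Type*) [AddCommGroup F] [Module R F]
    [AddCommGroup N] [Module R N] (J : Ideal R) :
    LinearMap.ker ((J • ⊤ : Submodule R N).mkQ.lTensor F) = J • ⊤ := by
  rw [lTensor_mkQ]
  apply le_antisymm
  · rintro _ ⟨x, rfl⟩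
    induction x using TensorProduct.induction_on with
    | zero => simp
    | add x y hx hy => rw [map_add]; exact add_mem hx hy
    | tmul x y =>
      obtain ⟨y, hy⟩ := y
      rw [LinearMap.lTensor_tmul, Submodule.subtype_apply]
      change y ∈ (J • ⊤ : Submodule R (F ⊗[R] N)).comap (TensorProduct.mk R F N x)
      refine (Submodule.map_le_iff_le_comap.1 ?_) hy
      rw [Submodule.map_smul'']
      exact smul_mono_right _ le_top
  · rw [Submodule.smul_le]
    rintro r hr x -
    induction x using TensorProduct.induction_on with
    | zero => simp
    | add x y hx hy => rw [smul_add]; exact add_mem hx hy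
    | tmul x y =>
      exact ⟨x ⊗ₜ ⟨r • y, Submodule.smul_mem_smul hr trivial⟩, by simp⟩

theorem length_homologyOne_of_surjective {F₀ F₁ F₂ N L : Type*}
    [AddCommGroup F₀] [Module R F₀] [AddCommGroup F₁] [Module R F₁]
    [AddCommGroup F₂] [Module R F₂] [AddCommGroup N] [Module R N] [AddCommGroup L] [Module R L]
    (ψ : F₂ →ₗ[R] F₁) (φ : F₁ →ₗ[R] F₀) (q : N →ₗ[R] L) (hq : Function.Surjective q) :
    Module.length R (homologyOne ψ φ L) =
      Submodule.relLength (LinearMap.range (ψ.rTensor N) ⊔ LinearMap.ker (q.lTensor F₁))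
        ((LinearMap.ker (q.lTensor F₀)).comap (φ.rTensor N)) := by
  have hφ (x) : φ.rTensor L (q.lTensor F₁ x) = q.lTensor F₀ (φ.rTensor N x) := by
    rw [← LinearMap.comp_apply, ← LinearMap.comp_apply, LinearMap.rTensor_comp_lTensor,
      LinearMap.lTensor_comp_rTensor]
  have hψ (x) : ψ.rTensor L (q.lTensor F₂ x) = q.lTensor F₁ (ψ.rTensor N x) := by
    rw [← LinearMap.comp_apply, ← LinearMap.comp_apply, LinearMap.rTensor_comp_lTensor,
      LinearMap.lTensor_comp_rTensor]
  have hker (x) : x ∈ (LinearMap.ker (q.lTensor F₀)).comap (φ.rTensor N) ↔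
      q.lTensor F₁ x ∈ LinearMap.ker (φ.rTensor L) := by
    rw [Submodule.mem_comap, LinearMap.mem_ker, LinearMap.mem_ker, hφ]
  have hrange : LinearMap.range (ψ.rTensor L) =
      (LinearMap.range (ψ.rTensor N)).map (q.lTensor F₁) := by
    ext y
    constructor
    · rintro ⟨z, rfl⟩
      obtain ⟨x, rfl⟩ := LinearMap.lTensor_surjective F₂ hq z
      exact ⟨_, ⟨x, rfl⟩, (hψ x).symm⟩
    · rintro ⟨_, ⟨x, rfl⟩, rfl⟩
      exact ⟨_, hψ x⟩
  change Submodule.relLength (LinearMap.range (ψ.rTensor L)) (LinearMap.ker (φ.rTensor L)) = _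
  symm
  refine Submodule.relLength_eq_of_linearMap (q.lTensor F₁)
    (fun x hx => (hker x).1 hx) (fun x _ => ?_) fun y hy => ?_
  · rw [hrange, ← Submodule.mem_comap, Submodule.comap_map_eq]
  · obtain ⟨x, rfl⟩ := LinearMap.lTensor_surjective F₁ hq y
    exact Submodule.mem_sup_right ⟨x, (hker x).2 hy, rfl⟩

theorem length_homologyOne {F₀ F₁ F₂ N : Type*}
    [AddCommGroup F₀] [Module R F₀] [AddCommGroup F₁] [Module R F₁]
    [AddCommGroup F₂] [Module R F₂] [AddCommGroup N] [Module R N]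
    (ψ : F₂ →ₗ[R] F₁) (φ : F₁ →ₗ[R] F₀) (J : Ideal R) :
    Module.length R (homologyOne ψ φ (N ⧸ (J • ⊤ : Submodule R N))) =
      Submodule.relLength (LinearMap.range (ψ.rTensor N) ⊔ J • ⊤)
        ((J • ⊤ : Submodule R (F₀ ⊗[R] N)).comap (φ.rTensor N)) := by
  rw [length_homologyOne_of_surjective ψ φ _ (Submodule.mkQ_surjective (J • ⊤)),
    LinearMap.ker_lTensor_mkQ_smul_top, LinearMap.ker_lTensor_mkQ_smul_top]

end Tensor

/-- Proposition 3(a). Let `R` be a commutative Noetherian ring, `I` an ideal,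
`N` a finitely generated `R`-module, and `C : F₂ →ψ F₁ →φ F₀` a complex of `R`-modules with
`F₀`, `F₁` finitely generated.  If `H₁(C ⊗ N/IⁿN)` has finite length for all `n ≫ 0`, then
there is a polynomial `p ∈ ℚ[X]` with `λ(H₁(C ⊗ N/IⁿN)) = p(n)` for all `n ≫ 0`. -/
theorem stmt_5 {R : Type*} [CommRing R] [IsNoetherianRing R] (I : Ideal R)
    {N : Type*} [AddCommGroup N] [Module R N] [Module.Finite R N]
    {F₀ F₁ F₂ : Type*}
    [AddCommGroup F₀] [Module R F₀] [AddCommGroup F₁] [Module R F₁]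
    [AddCommGroup F₂] [Module R F₂]
    [Module.Finite R F₀] [Module.Finite R F₁]
    (ψ : F₂ →ₗ[R] F₁) (φ : F₁ →ₗ[R] F₀) (hc : φ ∘ₗ ψ = 0)
    (hfin : ∃ N₀ : ℕ, ∀ n ≥ N₀,
      IsFiniteLength R (homologyOne ψ φ (N ⧸ (I ^ n • ⊤ : Submodule R N)))) :
    ∃ (p : Polynomial ℚ) (N₀ : ℕ), ∀ n ≥ N₀, ∃ ℓ : ℕ,
      moduleLength R (homologyOne ψ φ (N ⧸ (I ^ n • ⊤ : Submodule R N))) = ℓ ∧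
      (ℓ : ℚ) = p.eval (n : ℚ) := by
  obtain ⟨N₀, hN₀⟩ := hfin
  have hrange : LinearMap.range (ψ.rTensor N) ≤ LinearMap.ker (φ.rTensor N) := by
    rw [LinearMap.range_le_ker_iff, ← LinearMap.rTensor_comp, hc, LinearMap.rTensor_zero]
  obtain ⟨p, N₁, hp⟩ := Submodule.eventuallyPolynomial_relLength_comap I (φ.rTensor N) hrange N₀
    fun n hn => by
      rw [← length_homologyOne, Module.length_ne_top_iff]
      exact hN₀ n hn
  refine ⟨p, N₁, fun n hn => ?_⟩
  obtain ⟨ℓ, hℓ, hℓ'⟩ := hp n hn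
  refine ⟨ℓ, ?_, hℓ'⟩
  rw [moduleLength, ← Module.coe_length, length_homologyOne]
  exact congrArg WithBot.some hℓ
end
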